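/- arXiv:cond-mat/9911406 — 3 statements merged into one kernel-verified Lean document; each statement's English description precedes it below -/
import Mathlib

section
/- Let N ≥ 1, t ≥ 1, and let y^i_1 < … < y^i_N and y^f_1 < … < y^f_N be integers. For arbitrary vertex weights (no free fermion condition assumed), Σ_{σ ∈ S_N} sign(σ) · Σ_{(X_1,…,X_N)} Π_{α=1}^N W(X_α) = 0, where the inner sum is over all N-tuples of length-t walks with X_α running from y^i_α to y^f_{σ(α)} and such that at least two of the N walks have an edge of the lattice in common. -/
namespace OscSixVertex

open Finset

attribute [local instance] Classical.propDecidable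

variable {R : Type*} [CommRing R]

/-- The integer value of a step: `true` is an up (+1) step, `false` a down (−1) step. -/
def stepVal (b : Bool) : ℤ := if b then 1 else -1

/-- The step taken by the walk with step sequence `σ` between times `s` and `s+1`. -/
def stepAt {t : ℕ} (σ : Fin t → Bool) (s : ℕ) : ℤ :=
  if h : s < t then stepVal (σ ⟨s, h⟩) else 0

/-- The height at time `s` of the length-`t` walk starting at `a` with step sequence `σ`. -/
def height {t : ℕ} (a : ℤ) (σ : Fin t → Bool) (s : ℕ) : ℤ :=
  a + ∑ j ∈ Finset.range s, stepAt σ j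

/-- The local vertex weight at vertex `v`, given incoming step `din` and outgoing step `dout`:
`w3` for (+1,+1), `w4` for (−1,−1), `w5` for a peak (+1,−1), `w6` for a valley (−1,+1). -/
def localW (w3 w4 w5 w6 : ℕ × ℤ → R) (v : ℕ × ℤ) (din dout : ℤ) : R :=
  if din = 1 then (if dout = 1 then w3 v else w5 v)
  else (if dout = 1 then w6 v else w4 v)

/-- The vertex weight `W(X)` of a single walk: product over interior times `1 ≤ s ≤ t−1`. -/
def walkW (w3 w4 w5 w6 : ℕ × ℤ → R) {t : ℕ} (a : ℤ) (σ : Fin t → Bool) : R :=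
  ∏ s ∈ Finset.Ico 1 t,
    localW w3 w4 w5 w6 (s, height a σ s) (stepAt σ (s - 1)) (stepAt σ s)

/-- The single-walk generating function `F_t(a → b)`. -/
def genF (w3 w4 w5 w6 : ℕ × ℤ → R) (t : ℕ) (a b : ℤ) : R :=
  ∑ σ ∈ Finset.univ.filter (fun σ : Fin t → Bool => height a σ t = b),
    walkW w3 w4 w5 w6 a σ

/-- Two walks share an edge. -/
def SharesEdge {t : ℕ} (a₁ : ℤ) (σ₁ : Fin t → Bool) (a₂ : ℤ) (σ₂ : Fin t → Bool) : Prop :=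
  ∃ s, s < t ∧ height a₁ σ₁ s = height a₂ σ₂ s ∧ height a₁ σ₁ (s + 1) = height a₂ σ₂ (s + 1)

/-- The walk has a peak at time `s`: step in +1, step out −1. -/
def PeakAt {t : ℕ} (σ : Fin t → Bool) (s : ℕ) : Prop :=
  stepAt σ (s - 1) = 1 ∧ stepAt σ s = -1

/-- The walk has a valley at time `s`: step in −1, step out +1. -/
def ValleyAt {t : ℕ} (σ : Fin t → Bool) (s : ℕ) : Prop :=
  stepAt σ (s - 1) = -1 ∧ stepAt σ s = 1

/-- A pair of walks is osculating: no shared edge, and at every shared interior vertex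
one walk has a peak and the other a valley. -/
def OscPair {t : ℕ} (a₁ : ℤ) (σ₁ : Fin t → Bool) (a₂ : ℤ) (σ₂ : Fin t → Bool) : Prop :=
  ¬ SharesEdge a₁ σ₁ a₂ σ₂ ∧
  ∀ s, 1 ≤ s → s < t → height a₁ σ₁ s = height a₂ σ₂ s →
    ((PeakAt σ₁ s ∧ ValleyAt σ₂ s) ∨ (ValleyAt σ₁ s ∧ PeakAt σ₂ s))

/-- An `N`-walk is osculating if each pair of its walks is osculating. -/
def OscNWalk {N t : ℕ} (a : Fin N → ℤ) (σ : Fin N → Fin t → Bool) : Prop :=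
  ∀ α β, α ≠ β → OscPair (a α) (σ α) (a β) (σ β)

/-- The vertex weight `𝒲(X)` of an osculating `N`-walk: product over all interior vertices
visited; a vertex shared by two walks contributes `w2`, any other vertex contributes the
single-walk weight of the unique walk through it. -/
def oscW (w2 w3 w4 w5 w6 : ℕ × ℤ → R) {N t : ℕ}
    (a : Fin N → ℤ) (σ : Fin N → Fin t → Bool) : R :=
  ∏ s ∈ Finset.Ico 1 t,
    ∏ h ∈ Finset.image (fun α => height (a α) (σ α) s) Finset.univ,
      if ∃ α β : Fin N, α ≠ β ∧ height (a α) (σ α) s = h ∧ height (a β) (σ β) s = h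
      then w2 (s, h)
      else ∏ α ∈ Finset.univ.filter (fun α : Fin N => height (a α) (σ α) s = h),
        localW w3 w4 w5 w6 (s, h) (stepAt (σ α) (s - 1)) (stepAt (σ α) s)

/-- Interchange the tails of the two step sequences at every time in `S`:
the result follows `σ₁` while the number of switch times passed so far is even,
and `σ₂` when it is odd. -/
def swapSteps {t : ℕ} (σ₁ σ₂ : Fin t → Bool) (S : Finset ℕ) : Fin t → Bool :=
  fun j => if Even ((S.filter (fun s => s ≤ (j : ℕ))).card) then σ₁ j else σ₂ j


/-- Exchange the tails after time `s` among the walks according to `τ`: walk `α` keeps its steps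
up to and including step `s`, and then follows the steps of walk `τ α`. -/
def tailPerm {N t : ℕ} (s : ℕ) (τ : Equiv.Perm (Fin N)) (σ : Fin N → Fin t → Bool) :
    Fin N → Fin t → Bool :=
  fun α j => if (j : ℕ) ≤ s then σ α j else σ (τ α) j

section TailPerm

variable {N t s : ℕ} {τ : Equiv.Perm (Fin N)} {σ : Fin N → Fin t → Bool} {a : Fin N → ℤ}
  {α β : Fin N} {k : ℕ}

lemma stepAt_tailPerm_of_le (hk : k ≤ s) : stepAt (tailPerm s τ σ α) k = stepAt (σ α) k := by
  simp [stepAt, tailPerm, hk]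

lemma stepAt_tailPerm_of_lt (hk : s < k) : stepAt (tailPerm s τ σ α) k = stepAt (σ (τ α)) k := by
  simp [stepAt, tailPerm, hk.not_ge]

lemma height_succ {a : ℤ} {ω : Fin t → Bool} (k : ℕ) :
    height a ω (k + 1) = height a ω k + stepAt ω k := by
  simp [height, Finset.sum_range_succ, add_assoc]

lemma height_tailPerm_of_le (hk : k ≤ s + 1) :
    height (a α) (tailPerm s τ σ α) k = height (a α) (σ α) k := by
  unfold height
  congr 1
  refine Finset.sum_congr rfl fun j hj => stepAt_tailPerm_of_le ?_
  have := Finset.mem_range.1 hj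
  omega

lemma height_tailPerm_of_lt
    (h : height (a α) (σ α) (s + 1) = height (a (τ α)) (σ (τ α)) (s + 1)) (hk : s < k) :
    height (a α) (tailPerm s τ σ α) k = height (a (τ α)) (σ (τ α)) k := by
  induction k, hk using Nat.le_induction with
  | base => rw [height_tailPerm_of_le le_rfl, h]
  | succ k hk ih => rw [height_succ, height_succ, ih, stepAt_tailPerm_of_lt hk]

lemma tailPerm_tailPerm (hτ : ∀ α, τ (τ α) = α) : tailPerm s τ (tailPerm s τ σ) = σ := by
  funext α j
  by_cases hj : (j : ℕ) ≤ s <;> simp [tailPerm, hj, hτ]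

/-- Exchanging tails along shared edges preserves the total weight. -/
lemma prod_walkW_tailPerm (w3 w4 w5 w6 : ℕ × ℤ → R)
    (h₀ : ∀ α, height (a α) (σ α) s = height (a (τ α)) (σ (τ α)) s)
    (h₁ : ∀ α, height (a α) (σ α) (s + 1) = height (a (τ α)) (σ (τ α)) (s + 1)) :
    ∏ α, walkW w3 w4 w5 w6 (a α) (tailPerm s τ σ α) =
      ∏ α, walkW w3 w4 w5 w6 (a α) (σ α) := by
  unfold walkW
  rw [Finset.prod_comm, Finset.prod_comm (s := Finset.univ)]
  refine Finset.prod_congr rfl fun k _ => ?_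
  rcases le_or_gt k s with hk | hk
  · refine Finset.prod_congr rfl fun α _ => ?_
    rw [height_tailPerm_of_le (by omega), stepAt_tailPerm_of_le (by omega),
      stepAt_tailPerm_of_le hk]
  · rw [← Equiv.prod_comp τ fun α =>
      localW w3 w4 w5 w6 (k, height (a α) (σ α) k) (stepAt (σ α) (k - 1)) (stepAt (σ α) k)]
    refine Finset.prod_congr rfl fun α _ => ?_
    have hin : stepAt (tailPerm s τ σ α) (k - 1) = stepAt (σ (τ α)) (k - 1) := by
      rcases (show s ≤ k - 1 by omega).eq_or_lt with hs | hs
      · rw [← hs, stepAt_tailPerm_of_le le_rfl]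
        have := h₁ α
        rw [height_succ, height_succ, h₀ α] at this
        exact add_left_cancel this
      · exact stepAt_tailPerm_of_lt hs
    rw [height_tailPerm_of_lt (h₁ α) hk, hin, stepAt_tailPerm_of_lt hk]

/-- The distinct walks `α` and `β` share the edge between times `s` and `s + 1`. -/
def MeetAlong (a : Fin N → ℤ) (σ : Fin N → Fin t → Bool) (s : ℕ) (α β : Fin N) : Prop :=
  α ≠ β ∧ s < t ∧ height (a α) (σ α) s = height (a β) (σ β) s ∧
    height (a α) (σ α) (s + 1) = height (a β) (σ β) (s + 1)

lemma meetAlong_tailPerm (hk : k ≤ s) :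
    MeetAlong a (tailPerm s τ σ) k α β ↔ MeetAlong a σ k α β := by
  simp only [MeetAlong, height_tailPerm_of_le (show k ≤ s + 1 by omega),
    height_tailPerm_of_le (show k + 1 ≤ s + 1 by omega)]

/-- The first time at which two walks start along a common edge. -/
noncomputable def firstMeet (a : Fin N → ℤ) (σ : Fin N → Fin t → Bool) : ℕ :=
  sInf {s | ∃ α β, MeetAlong a σ s α β}

/-- A pair of walks meeting along an edge at the first possible time. -/
noncomputable def meetPair [NeZero N] (a : Fin N → ℤ) (σ : Fin N → Fin t → Bool) : Fin N × Fin N :=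
  Classical.epsilon fun p => MeetAlong a σ (firstMeet a σ) p.1 p.2

/-- The transposition of the pair of walks selected by `meetPair`. -/
noncomputable def meetSwap [NeZero N] (a : Fin N → ℤ) (σ : Fin N → Fin t → Bool) :
    Equiv.Perm (Fin N) :=
  Equiv.swap (meetPair a σ).1 (meetPair a σ).2

lemma meetAlong_meetPair [NeZero N]
    (h : ∃ α β, α ≠ β ∧ SharesEdge (a α) (σ α) (a β) (σ β)) :
    MeetAlong a σ (firstMeet a σ) (meetPair a σ).1 (meetPair a σ).2 := by
  obtain ⟨α, β, hαβ, s, hs⟩ := h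
  obtain ⟨α', β', h'⟩ := Nat.sInf_mem (s := {s | ∃ α β, MeetAlong a σ s α β})
    ⟨s, α, β, hαβ, hs⟩
  exact Classical.epsilon_spec
    (p := fun p : Fin N × Fin N => MeetAlong a σ (firstMeet a σ) p.1 p.2) ⟨(α', β'), h'⟩

lemma MeetAlong.sharesEdge (h : MeetAlong a σ s α β) :
    ∃ α β, α ≠ β ∧ SharesEdge (a α) (σ α) (a β) (σ β) :=
  ⟨α, β, h.1, s, h.2⟩

lemma firstMeet_tailPerm (h : MeetAlong a σ (firstMeet a σ) α β) :
    firstMeet a (tailPerm (firstMeet a σ) τ σ) = firstMeet a σ := by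
  refine le_antisymm (Nat.sInf_le ⟨α, β, (meetAlong_tailPerm le_rfl).2 h⟩) ?_
  by_contra! hlt
  obtain ⟨α', β', h'⟩ := Nat.sInf_mem
    (s := {s | ∃ α β, MeetAlong a (tailPerm (firstMeet a σ) τ σ) s α β})
    ⟨_, α, β, (meetAlong_tailPerm le_rfl).2 h⟩
  exact hlt.not_ge (Nat.sInf_le ⟨α', β', (meetAlong_tailPerm hlt.le).1 h'⟩)

lemma meetPair_tailPerm [NeZero N] (h : MeetAlong a σ (firstMeet a σ) α β) :
    meetPair a (tailPerm (firstMeet a σ) τ σ) = meetPair a σ := by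
  simp only [meetPair, firstMeet_tailPerm h, meetAlong_tailPerm le_rfl]

/-- A function agreeing at `α` and `β` is invariant under the transposition of `α` and `β`. -/
lemma apply_swap_of_eq {γ : Type*} (f : Fin N → γ) (h : f α = f β) (δ : Fin N) :
    f δ = f (Equiv.swap α β δ) := by
  by_cases h₁ : δ = α
  · simp [h₁, h]
  · by_cases h₂ : δ = β
    · simp [h₂, h]
    · rw [Equiv.swap_apply_of_ne_of_ne h₁ h₂]

end TailPerm

/-- **Cancellation of edge-sharing configurations.**
For arbitrary vertex weights, the signed sum over permutations `π` and over `N`-tuples of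
walks joining `yⁱ_α` to `yᶠ_{π α}` in which at least two walks share an edge vanishes. -/
theorem edge_sharing_cancellation {R : Type*} [CommRing R]
    (N t : ℕ) (hN : 1 ≤ N) (htpos : 1 ≤ t)
    (w3 w4 w5 w6 : ℕ × ℤ → R)
    (yi yf : Fin N → ℤ) (hyi : StrictMono yi) (hyf : StrictMono yf) :
    ∑ π : Equiv.Perm (Fin N),
      ((Equiv.Perm.sign π : ℤ) : R) *
        ∑ σ ∈ Finset.univ.filter (fun σ : Fin N → Fin t → Bool =>
            (∀ α, height (yi α) (σ α) t = yf (π α)) ∧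
            ∃ α β, α ≠ β ∧ SharesEdge (yi α) (σ α) (yi β) (σ β)),
          ∏ α, walkW w3 w4 w5 w6 (yi α) (σ α)
    = 0 := by
  have : NeZero N := ⟨by omega⟩
  simp only [Finset.mul_sum]
  rw [Finset.sum_sigma']
  let flip : (_ : Equiv.Perm (Fin N)) × (Fin N → Fin t → Bool) →
      (_ : Equiv.Perm (Fin N)) × (Fin N → Fin t → Bool) :=
    fun x => ⟨x.1 * meetSwap yi x.2, tailPerm (firstMeet yi x.2) (meetSwap yi x.2) x.2⟩
  refine Finset.sum_involution (fun x _ => flip x) ?_ ?_ ?_ ?_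
  · rintro ⟨π, σ⟩ hx
    have hm := meetAlong_meetPair (Finset.mem_filter.1 (Finset.mem_sigma.1 hx).2).2.2
    have hsign : Equiv.Perm.sign (π * meetSwap yi σ) = -Equiv.Perm.sign π := by
      rw [Equiv.Perm.sign_mul, meetSwap, Equiv.Perm.sign_swap hm.1, mul_neg_one]
    simp only [flip]
    rw [prod_walkW_tailPerm (τ := meetSwap yi σ) w3 w4 w5 w6
      (apply_swap_of_eq (fun δ => height (yi δ) (σ δ) (firstMeet yi σ)) hm.2.2.1)
      (apply_swap_of_eq (fun δ => height (yi δ) (σ δ) (firstMeet yi σ + 1)) hm.2.2.2), hsign]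
    push_cast
    ring
  · rintro ⟨π, σ⟩ hx _ heq
    have hm := meetAlong_meetPair (Finset.mem_filter.1 (Finset.mem_sigma.1 hx).2).2.2
    have h1 : π * meetSwap yi σ = π := congrArg Sigma.fst heq
    exact hm.1 (Equiv.swap_eq_one_iff.1 (mul_eq_left.1 h1))
  · rintro ⟨π, σ⟩ hx
    obtain ⟨hend, hshare⟩ := (Finset.mem_filter.1 (Finset.mem_sigma.1 hx).2).2
    have hm := meetAlong_meetPair hshare
    refine Finset.mem_sigma.2 ⟨Finset.mem_univ _, Finset.mem_filter.2 ⟨Finset.mem_univ _, ?_, ?_⟩⟩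
    · intro α
      change height (yi α) (tailPerm (firstMeet yi σ) (meetSwap yi σ) σ α) t = _
      rw [height_tailPerm_of_lt (τ := meetSwap yi σ) (apply_swap_of_eq
        (fun δ => height (yi δ) (σ δ) (firstMeet yi σ + 1)) hm.2.2.2 α) hm.2.1]
      exact hend _
    · exact ((meetAlong_tailPerm le_rfl).2 hm).sharesEdge
  · rintro ⟨π, σ⟩ hx
    have hm := meetAlong_meetPair (Finset.mem_filter.1 (Finset.mem_sigma.1 hx).2).2.2
    have hswap : meetSwap yi (tailPerm (firstMeet yi σ) (meetSwap yi σ) σ) = meetSwap yi σ := by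
      rw [meetSwap, meetPair_tailPerm hm, meetSwap]
    simp only [flip, hswap, firstMeet_tailPerm hm]
    rw [tailPerm_tailPerm (τ := meetSwap yi σ) fun α => Equiv.swap_apply_self _ _ α, mul_assoc, meetSwap,
      Equiv.swap_mul_self, mul_one]

end OscSixVertex
end

section
/- Let X_1, X_2 be two length-t walks given by y_1, y_2, and let 0 < s < t be a time with y_1(s) = y_2(s) =: h; set v = (s,h). Suppose X_1 has a peak at v (y_1(s)−y_1(s−1)=+1 and y_1(s+1)−y_1(s)=−1) and X_2 has a valley at v (y_2(s)−y_2(s−1)=−1 and y_2(s+1)−y_2(s)=+1). Let X'_1, X'_2 be the walks obtained by exchanging X_1 and X_2 at time s, i.e. y'_1 agrees with y_1 on {0,…,s} and with y_2 on {s,…,t}, and y'_2 agrees with y_2 on {0,…,s} and with y_1 on {s,…,t}. Then W(X_1)·W(X_2) − W(X'_1)·W(X'_2) = (w5(v)·w6(v) − w3(v)·w4(v)) · Π, where Π is the product over all interior vertices u ≠ v of all weights contributed at u by X_1 and X_2 (equivalently, Π is W(X_1)·W(X_2) with the factor w5(v)·w6(v) removed). -/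
namespace OscSixVertex

open Finset

attribute [local instance] Classical.propDecidable

variable {R : Type*} [CommRing R]

theorem stepAt_ite_lt {t : ℕ} (σ₁ σ₂ : Fin t → Bool) (s u : ℕ) :
    stepAt (fun j => if (j : ℕ) < s then σ₁ j else σ₂ j) u
      = if u < s then stepAt σ₁ u else stepAt σ₂ u := by
  unfold stepAt
  by_cases h : u < s <;> simp [h]

/-- Up to the exchange time the exchanged walk has the heights of the first walk. -/
theorem height_ite_lt_of_le {t : ℕ} (a : ℤ) (σ₁ σ₂ : Fin t → Bool) {s u : ℕ} (hu : u ≤ s) :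
    height a (fun j => if (j : ℕ) < s then σ₁ j else σ₂ j) u = height a σ₁ u := by
  unfold height
  congr 1
  refine Finset.sum_congr rfl fun j hj => ?_
  rw [stepAt_ite_lt, if_pos ((Finset.mem_range.mp hj).trans_le hu)]

/-- If the walks meet at the exchange time, then from that time on the exchanged walk has the
heights of the second walk. -/
theorem height_ite_lt_of_ge {t : ℕ} {a₁ a₂ : ℤ} {σ₁ σ₂ : Fin t → Bool} {s u : ℕ}
    (hmeet : height a₁ σ₁ s = height a₂ σ₂ s) (hu : s ≤ u) :
    height a₁ (fun j => if (j : ℕ) < s then σ₁ j else σ₂ j) u = height a₂ σ₂ u := by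
  induction u, hu using Nat.le_induction with
  | base => rw [height_ite_lt_of_le _ _ _ le_rfl, hmeet]
  | succ u hu ih =>
    unfold height at ih ⊢
    rw [Finset.sum_range_succ, Finset.sum_range_succ, ← add_assoc, ← add_assoc, ih,
      stepAt_ite_lt, if_neg hu.not_gt]

/-- The weight contributed by a walk at time `u`. -/
def weightAt (w3 w4 w5 w6 : ℕ × ℤ → R) {t : ℕ} (a : ℤ) (σ : Fin t → Bool) (u : ℕ) : R :=
  localW w3 w4 w5 w6 (u, height a σ u) (stepAt σ (u - 1)) (stepAt σ u)

theorem walkW_eq_weightAt_mul_prod_erase (w3 w4 w5 w6 : ℕ × ℤ → R) {t : ℕ} (a : ℤ)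
    (σ : Fin t → Bool) {s : ℕ} (hs0 : 0 < s) (hst : s < t) :
    walkW w3 w4 w5 w6 a σ = weightAt w3 w4 w5 w6 a σ s
      * ∏ u ∈ (Finset.Ico 1 t).erase s, weightAt w3 w4 w5 w6 a σ u :=
  (Finset.mul_prod_erase _ _ (Finset.mem_Ico.mpr ⟨hs0, hst⟩)).symm

theorem weightAt_ite_lt {R : Type*} (w3 w4 w5 w6 : ℕ × ℤ → R)
    {t : ℕ} {a₁ a₂ : ℤ}
    {σ₁ σ₂ : Fin t → Bool} {s u : ℕ} (hmeet : height a₁ σ₁ s = height a₂ σ₂ s) (hu : u ≠ s) :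
    weightAt w3 w4 w5 w6 a₁ (fun j => if (j : ℕ) < s then σ₁ j else σ₂ j) u
      = if u < s then weightAt w3 w4 w5 w6 a₁ σ₁ u else weightAt w3 w4 w5 w6 a₂ σ₂ u := by
  unfold weightAt
  rw [stepAt_ite_lt, stepAt_ite_lt]
  rcases hu.lt_or_gt with h | h
  · rw [height_ite_lt_of_le _ _ _ h.le, if_pos h, if_pos h, if_pos (by omega)]
  · rw [height_ite_lt_of_ge hmeet h.le, if_neg h.not_gt, if_neg h.not_gt, if_neg (by omega)]

/-- At the exchange time the exchanged walk enters as the first walk and leaves as the second. -/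
theorem weightAt_ite_lt_self {R : Type*} (w3 w4 w5 w6 : ℕ × ℤ → R)
    {t : ℕ} (a : ℤ)
    (σ₁ σ₂ : Fin t → Bool) {s : ℕ} (hs0 : 0 < s) :
    weightAt w3 w4 w5 w6 a (fun j => if (j : ℕ) < s then σ₁ j else σ₂ j) s
      = localW w3 w4 w5 w6 (s, height a σ₁ s) (stepAt σ₁ (s - 1)) (stepAt σ₂ s) := by
  unfold weightAt
  rw [height_ite_lt_of_le _ _ _ le_rfl, stepAt_ite_lt, stepAt_ite_lt, if_pos (by omega),
    if_neg (lt_irrefl s)]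

/-- Exchanging two walks where they meet does not change the product of the weights they
contribute at the other times. -/
theorem prod_erase_weightAt_exchange (w3 w4 w5 w6 : ℕ × ℤ → R) {t : ℕ} {a₁ a₂ : ℤ}
    {σ₁ σ₂ : Fin t → Bool} {s : ℕ} (hmeet : height a₁ σ₁ s = height a₂ σ₂ s)
    (T : Finset ℕ) :
    (∏ u ∈ T.erase s,
        weightAt w3 w4 w5 w6 a₁ (fun j => if (j : ℕ) < s then σ₁ j else σ₂ j) u)
      * (∏ u ∈ T.erase s,
        weightAt w3 w4 w5 w6 a₂ (fun j => if (j : ℕ) < s then σ₂ j else σ₁ j) u)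
    = (∏ u ∈ T.erase s, weightAt w3 w4 w5 w6 a₁ σ₁ u)
      * (∏ u ∈ T.erase s, weightAt w3 w4 w5 w6 a₂ σ₂ u) := by
  rw [← Finset.prod_mul_distrib, ← Finset.prod_mul_distrib]
  refine Finset.prod_congr rfl fun u hu => ?_
  have hne := Finset.ne_of_mem_erase hu
  rw [weightAt_ite_lt _ _ _ _ hmeet hne, weightAt_ite_lt _ _ _ _ hmeet.symm hne]
  split_ifs
  · rfl
  · exact mul_comm _ _

/-- **Exchange at an osculation/switch vertex.**
If walk 1 has a peak and walk 2 a valley at a common interior vertex `v = (s, h)`, and the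
walks are exchanged at time `s` (tails swapped), then the difference of the products of
single-walk weights is `(w5 v · w6 v − w3 v · w4 v)` times the product of all the weights
contributed by the two walks at the interior vertices other than `v`. -/
theorem exchange_at_osculation {R : Type*} [CommRing R]
    (t : ℕ) (w3 w4 w5 w6 : ℕ × ℤ → R)
    (a₁ a₂ : ℤ) (σ₁ σ₂ : Fin t → Bool) (s : ℕ) (hs0 : 0 < s) (hst : s < t)
    (hmeet : height a₁ σ₁ s = height a₂ σ₂ s)
    (hpeak₁ : stepAt σ₁ (s - 1) = 1 ∧ stepAt σ₁ s = -1)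
    (hvalley₂ : stepAt σ₂ (s - 1) = -1 ∧ stepAt σ₂ s = 1) :
    walkW w3 w4 w5 w6 a₁ σ₁ * walkW w3 w4 w5 w6 a₂ σ₂
      - walkW w3 w4 w5 w6 a₁ (fun j => if (j : ℕ) < s then σ₁ j else σ₂ j)
          * walkW w3 w4 w5 w6 a₂ (fun j => if (j : ℕ) < s then σ₂ j else σ₁ j)
    = (w5 (s, height a₁ σ₁ s) * w6 (s, height a₁ σ₁ s)
        - w3 (s, height a₁ σ₁ s) * w4 (s, height a₁ σ₁ s))
      * ((∏ u ∈ (Finset.Ico 1 t).erase s,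
            localW w3 w4 w5 w6 (u, height a₁ σ₁ u) (stepAt σ₁ (u - 1)) (stepAt σ₁ u))
        * (∏ u ∈ (Finset.Ico 1 t).erase s,
            localW w3 w4 w5 w6 (u, height a₂ σ₂ u) (stepAt σ₂ (u - 1)) (stepAt σ₂ u))) := by
  have hW₁ : weightAt w3 w4 w5 w6 a₁ σ₁ s = w5 (s, height a₁ σ₁ s) := by
    simp [weightAt, localW, hpeak₁]
  have hW₂ : weightAt w3 w4 w5 w6 a₂ σ₂ s = w6 (s, height a₁ σ₁ s) := by
    simp [weightAt, localW, hvalley₂, hmeet]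
  have hprod := prod_erase_weightAt_exchange w3 w4 w5 w6 hmeet (Finset.Ico 1 t)
  simp only [walkW_eq_weightAt_mul_prod_erase _ _ _ _ _ _ hs0 hst, hW₁, hW₂,
    weightAt_ite_lt_self _ _ _ _ _ _ _ hs0, hpeak₁, hvalley₂, ← hmeet]
  simp only [localW, reduceIte, show ¬((-1 : ℤ) = 1) by decide]
  rw [mul_mul_mul_comm, mul_mul_mul_comm (w3 _), hprod, ← sub_mul]
  rfl

end OscSixVertex
end

section
/- Let (X_1, X_2) be an osculating pair of length-t walks (sharing no edge, every shared interior vertex an osculation) with set E of shared interior vertices. Then the pairs of walks obtained from (X_1,X_2) by choosing, independently at each vertex of E, either to keep the osculation or to replace it by a crossing (interchanging the outgoing local steps of the two walks at that vertex) are pairwise distinct; in particular there are exactly 2^{|E|} such pairs. -/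
namespace OscSixVertex

open Finset

attribute [local instance] Classical.propDecidable

variable {R : Type*} [CommRing R]

/-- Where the two walks take different steps, a resolution reveals the parity of the number of
switch times passed so far. -/
theorem even_card_iff_of_swapSteps_eq {t : ℕ} {σ₁ σ₂ : Fin t → Bool} {S₁ S₂ : Finset ℕ}
    (h : swapSteps σ₁ σ₂ S₁ = swapSteps σ₁ σ₂ S₂) {j : Fin t} (hj : σ₁ j ≠ σ₂ j) :
    Even (S₁.filter (fun s => s ≤ (j : ℕ))).card ↔
      Even (S₂.filter (fun s => s ≤ (j : ℕ))).card := by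
  have hv := congrFun h j
  unfold swapSteps at hv
  split_ifs at hv with h₁ h₂ h₂
  · exact iff_of_true h₁ h₂
  · exact absurd hv hj
  · exact absurd hv.symm hj
  · exact iff_of_false h₁ h₂

/-- A time belongs to `S` iff the parity of the number of elements of `S` passed changes there. -/
theorem mem_iff_even_card_filter_le_succ (S : Finset ℕ) (n : ℕ) :
    n + 1 ∈ S ↔ ¬ (Even (S.filter (fun s => s ≤ n + 1)).card ↔
      Even (S.filter (fun s => s ≤ n)).card) := by
  by_cases hn : n + 1 ∈ S
  · have hs : S.filter (fun s => s ≤ n + 1) = insert (n + 1) (S.filter (fun s => s ≤ n)) := by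
      ext x
      simp only [mem_filter, mem_insert]
      grind
    rw [hs, card_insert_of_notMem (by simp), Nat.even_add_one]
    tauto
  · have hs : S.filter (fun s => s ≤ n + 1) = S.filter (fun s => s ≤ n) := by
      ext x
      simp only [mem_filter]
      grind
    simp [hs, hn]

theorem ne_of_stepAt_ne {t : ℕ} {σ₁ σ₂ : Fin t → Bool} {s : ℕ} (hs : s < t)
    (h : stepAt σ₁ s ≠ stepAt σ₂ s) : σ₁ ⟨s, hs⟩ ≠ σ₂ ⟨s, hs⟩ := by
  intro he
  exact h (by simp only [stepAt, dif_pos hs, he])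

/-- At an osculation the two walks differ both in the incoming and in the outgoing step. -/
theorem stepAt_ne_of_osculation {t : ℕ} {σ₁ σ₂ : Fin t → Bool} {s : ℕ}
    (h : (PeakAt σ₁ s ∧ ValleyAt σ₂ s) ∨ (ValleyAt σ₁ s ∧ PeakAt σ₂ s)) :
    stepAt σ₁ (s - 1) ≠ stepAt σ₂ (s - 1) ∧ stepAt σ₁ s ≠ stepAt σ₂ s := by
  unfold PeakAt ValleyAt at h
  omega

/-- The first walk of a resolution already determines the set of crossed osculations. -/
theorem swapSteps_injOn {t : ℕ} {σ₁ σ₂ : Fin t → Bool} {E : Finset ℕ}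
    (hE : ∀ s ∈ E, 1 ≤ s ∧ s < t ∧
      ((PeakAt σ₁ s ∧ ValleyAt σ₂ s) ∨ (ValleyAt σ₁ s ∧ PeakAt σ₂ s))) :
    Set.InjOn (swapSteps σ₁ σ₂) (E.powerset : Set (Finset ℕ)) := by
  intro S₁ hS₁ S₂ hS₂ h
  rw [mem_coe, mem_powerset] at hS₁ hS₂
  have key : ∀ s ∈ E, (s ∈ S₁ ↔ s ∈ S₂) := by
    intro s hs
    obtain ⟨h1, ht, hosc⟩ := hE s hs
    obtain ⟨n, rfl⟩ := Nat.exists_eq_add_of_le' h1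
    obtain ⟨hin, hout⟩ := stepAt_ne_of_osculation hosc
    have e₁ := even_card_iff_of_swapSteps_eq h (ne_of_stepAt_ne ht hout)
    have e₂ := even_card_iff_of_swapSteps_eq h (ne_of_stepAt_ne (Nat.lt_of_succ_lt ht) hin)
    rw [mem_iff_even_card_filter_le_succ S₁, mem_iff_even_card_filter_le_succ S₂, e₁, e₂]
  ext s
  exact ⟨fun hs => (key s (hS₁ hs)).1 hs, fun hs => (key s (hS₂ hs)).2 hs⟩

/-- **The `2^{|E|}` resolutions of an osculating pair are pairwise distinct.**
Let `(X₁, X₂)` be an osculating pair with set `E` of shared interior vertices (recorded by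
their times).  The pairs of walks obtained by independently keeping or crossing
(tail-swapping) the osculation at each time of `E` are pairwise distinct; in particular
there are exactly `2^{|E|}` of them. -/
theorem osculation_resolutions_distinct
    (t : ℕ) (a₁ a₂ : ℤ) (σ₁ σ₂ : Fin t → Bool)
    (hinit : a₁ ≠ a₂) (hfin : height a₁ σ₁ t ≠ height a₂ σ₂ t)
    (hosc : OscPair a₁ σ₁ a₂ σ₂)
    (E : Finset ℕ)
    (hE : E = (Finset.Ico 1 t).filter (fun s => height a₁ σ₁ s = height a₂ σ₂ s)) :
    (∀ S₁ ∈ E.powerset, ∀ S₂ ∈ E.powerset,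
        (swapSteps σ₁ σ₂ S₁, swapSteps σ₂ σ₁ S₁)
          = (swapSteps σ₁ σ₂ S₂, swapSteps σ₂ σ₁ S₂) → S₁ = S₂) ∧
    (E.powerset.image
        (fun S => (swapSteps σ₁ σ₂ S, swapSteps σ₂ σ₁ S))).card = 2 ^ E.card := by
  have inj : Set.InjOn (swapSteps σ₁ σ₂) (E.powerset : Set (Finset ℕ)) := by
    refine swapSteps_injOn fun s hs => ?_
    rw [hE, mem_filter, mem_Ico] at hs
    exact ⟨hs.1.1, hs.1.2, hosc.2 s hs.1.1 hs.1.2 hs.2⟩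
  have inj_pair : ∀ S₁ ∈ E.powerset, ∀ S₂ ∈ E.powerset,
      (swapSteps σ₁ σ₂ S₁, swapSteps σ₂ σ₁ S₁)
        = (swapSteps σ₁ σ₂ S₂, swapSteps σ₂ σ₁ S₂) → S₁ = S₂ :=
    fun S₁ h₁ S₂ h₂ h => inj (mem_coe.2 h₁) (mem_coe.2 h₂) (congrArg Prod.fst h)
  refine ⟨inj_pair, ?_⟩
  rw [card_image_of_injOn fun S₁ h₁ S₂ h₂ h =>
    inj_pair S₁ (mem_coe.1 h₁) S₂ (mem_coe.1 h₂) h, card_powerset]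

end OscSixVertex
end
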